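/- Let ξ̄ ∈ Ξ, let Φ be a real-valued function on p×p real matrices that is concave on positive semidefinite matrices and Löwner-increasing, and suppose Φ is Fréchet-differentiable at L(ξ̄) with derivative A ↦ trace(D * A) for a symmetric p×p matrix D. Let h(i) = ((Z(ξ̄)ᵀ)⁻¹ * F * D * Fᵀ * Z(ξ̄)⁻¹) i i. If δ > 0 and for every subset S of Fin N of cardinality n one has (1/n) · ∑_{i ∈ S} h(i) ≤ ∑_{i} ξ̄(i) · h(i) + δ, then Φ(L(ξ̄)) ≥ Φ(L(ξ)) − (κ/n)·δ for every ξ ∈ Ξ. -/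

import Mathlib

open Matrix

attribute [local instance] Matrix.normedAddCommGroup Matrix.normedSpace

/-- A function lying above a line of slope `m` to the right of `0` has derivative at least `m`. -/
theorem le_of_hasDerivAt_of_line_le {g : ℝ → ℝ} {d m : ℝ} (hg : HasDerivAt g d 0)
    (hm : ∀ t, 0 < t → t ≤ 1 → g 0 + t * m ≤ g t) : m ≤ d := by
  refine ge_of_tendsto hg.tendsto_slope_zero_right ?_
  filter_upwards [Ioc_mem_nhdsGT (zero_lt_one' ℝ)] with t ht
  have := hm t ht.1 ht.2
  rw [zero_add, smul_eq_mul, inv_mul_eq_div, le_div_iff₀ ht.1]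
  linarith

/-- The derivative along a line of a Fréchet differentiable function. -/
theorem HasFDerivAt.hasDerivAt_line {E : Type*} [NormedAddCommGroup E] [NormedSpace ℝ E]
    {f : E → ℝ} {f' : E →L[ℝ] ℝ} {x : E} (hf : HasFDerivAt f f' x) (v : E) :
    HasDerivAt (fun t : ℝ => f (x + t • v)) (f' v) 0 := by
  have hline : HasDerivAt (fun t : ℝ => x + t • v) v 0 := by
    simpa using ((hasDerivAt_id (0 : ℝ)).smul_const v).const_add x
  exact HasFDerivAt.comp_hasDerivAt (0 : ℝ) (by simpa using hf) hline

/-- A concave function lies below its tangent. -/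
theorem ConcaveOn.le_add_fderiv {E : Type*} [NormedAddCommGroup E] [NormedSpace ℝ E]
    {f : E → ℝ} {f' : E →L[ℝ] ℝ} {s : Set E} {x y : E} (hconc : ConcaveOn ℝ s f)
    (hf : HasFDerivAt f f' x) (hx : x ∈ s) (hy : y ∈ s) : f y ≤ f x + f' (y - x) := by
  have := le_of_hasDerivAt_of_line_le (m := f y - f x) (hf.hasDerivAt_line (y - x)) fun t h0 h1 => by
    have h := hconc.2 hx hy (sub_nonneg.2 h1) h0.le (sub_add_cancel 1 t)
    have e : x + t • (y - x) = (1 - t) • x + t • y := by module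
    simp only [smul_eq_mul] at h
    simp only [zero_smul, add_zero, e]
    linarith
  linarith

/-- The derivative of a Löwner-increasing function is nonnegative on positive semidefinite
matrices. -/
theorem fderiv_nonneg_of_loewner_mono {p : ℕ} {Φ : Matrix (Fin p) (Fin p) ℝ → ℝ}
    {ψ : Matrix (Fin p) (Fin p) ℝ →L[ℝ] ℝ} {A V : Matrix (Fin p) (Fin p) ℝ}
    (hmono : ∀ A B : Matrix (Fin p) (Fin p) ℝ, (B - A).PosSemidef → Φ A ≤ Φ B)
    (hd : HasFDerivAt Φ ψ A) (hV : V.PosSemidef) : 0 ≤ ψ V := by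
  refine le_of_hasDerivAt_of_line_le (hd.hasDerivAt_line V) fun t ht _ => ?_
  simp only [mul_zero, zero_smul, add_zero]
  refine hmono _ _ ?_
  rw [add_sub_cancel_left]
  exact hV.smul ht.le

/-- Every finite family of reals has `n` largest members. -/
theorem exists_card_eq_threshold {ι : Type*} [Fintype ι] [DecidableEq ι] (h : ι → ℝ) {n : ℕ}
    (hn : 0 < n) (hnN : n ≤ Fintype.card ι) :
    ∃ S : Finset ι, S.card = n ∧ ∃ t, (∀ i ∈ S, t ≤ h i) ∧ ∀ j ∉ S, h j ≤ t := by
  obtain ⟨S, hS, hmax⟩ := Finset.exists_max_image (Finset.powersetCard n (Finset.univ : Finset ι))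
    (fun S => ∑ i ∈ S, h i) (Finset.powersetCard_nonempty.2 (by simpa using hnN))
  have hcard : S.card = n := (Finset.mem_powersetCard.1 hS).2
  obtain ⟨i₀, hi₀, hmin⟩ := Finset.exists_min_image S h (Finset.card_pos.1 (hcard ▸ hn))
  refine ⟨S, hcard, h i₀, hmin, fun j hj => ?_⟩
  have hj' : j ∉ S.erase i₀ := fun hmem => hj (Finset.mem_of_mem_erase hmem)
  have hswap := hmax (insert j (S.erase i₀)) (Finset.mem_powersetCard.2 ⟨Finset.subset_univ _, by
    rw [Finset.card_insert_of_notMem hj', Finset.card_erase_add_one hi₀, hcard]⟩)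
  rw [Finset.sum_insert hj', ← Finset.add_sum_erase S h hi₀] at hswap
  linarith

/-- A linear functional on the capped simplex is bounded by its value at a uniform measure on
some `n`-subset. -/
theorem exists_card_eq_sum_mul_le {ι : Type*} [Fintype ι] [DecidableEq ι] (h ξ : ι → ℝ) {n : ℕ}
    (hn : 0 < n) (hnN : n ≤ Fintype.card ι) (hsum : ∑ i, ξ i = 1)
    (hξ : ∀ i, 0 ≤ ξ i ∧ ξ i ≤ 1 / (n : ℝ)) :
    ∃ S : Finset ι, S.card = n ∧ ∑ i, ξ i * h i ≤ (1 / (n : ℝ)) * ∑ i ∈ S, h i := by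
  obtain ⟨S, hS, t, hin, hout⟩ := exists_card_eq_threshold h hn hnN
  refine ⟨S, hS, ?_⟩
  have hn' : (n : ℝ) ≠ 0 := by positivity
  have key : ∑ i, (ξ i - if i ∈ S then 1 / (n : ℝ) else 0) * (h i - t) ≤ 0 := by
    refine Finset.sum_nonpos fun i _ => ?_
    by_cases hi : i ∈ S
    · simp only [hi, if_true]
      exact mul_nonpos_of_nonpos_of_nonneg (sub_nonpos.2 (hξ i).2) (sub_nonneg.2 (hin i hi))
    · simp only [hi, if_false, sub_zero]
      exact mul_nonpos_of_nonneg_of_nonpos (hξ i).1 (sub_nonpos.2 (hout i hi))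
  simp only [sub_mul, mul_sub, Finset.sum_sub_distrib, ← Finset.sum_mul, hsum, ite_mul, zero_mul,
    Finset.sum_ite_mem, Finset.univ_inter, ← Finset.mul_sum, Finset.sum_const, hS,
    nsmul_eq_mul] at key
  have e : (1 / (n : ℝ)) * (n * t) = t := by field_simp
  linarith

/-- For a nonnegative diagonal `X`, a positive definite `B` and `c > 0`, the matrix `X B + c`
becomes positive definite when multiplied by `B` on the left. -/
theorem posDef_mul_diagonal_mul_add {ι : Type*} [Fintype ι] [DecidableEq ι] {B : Matrix ι ι ℝ}
    (hB : B.PosDef) {c : ℝ} (hc : 0 < c) {ξ : ι → ℝ} (hξ : ∀ i, 0 ≤ ξ i) :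
    (B * (diagonal ξ * B + c • 1)).PosDef := by
  have hX : (diagonal ξ).PosSemidef := PosSemidef.diagonal hξ
  have h1 := hX.conjTranspose_mul_mul_same B
  rw [hB.isHermitian.eq] at h1
  rw [mul_add, mul_smul_comm, mul_one, ← mul_assoc]
  exact PosDef.posSemidef_add h1 (hB.smul hc)

theorem isUnit_det_diagonal_mul_add {ι : Type*} [Fintype ι] [DecidableEq ι] {B : Matrix ι ι ℝ}
    (hB : B.PosDef) {c : ℝ} (hc : 0 < c) {ξ : ι → ℝ} (hξ : ∀ i, 0 ≤ ξ i) :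
    IsUnit (diagonal ξ * B + c • 1).det := by
  have hW := (isUnit_iff_isUnit_det _).1 (posDef_mul_diagonal_mul_add hB hc hξ).isUnit
  rw [det_mul] at hW
  exact isUnit_of_mul_isUnit_right hW

theorem inv_mul_diagonal_eq {ι : Type*} [Fintype ι] [DecidableEq ι] {B : Matrix ι ι ℝ}
    (hB : B.PosDef) {c : ℝ} (hc : 0 < c) {ξ : ι → ℝ} (hξ : ∀ i, 0 ≤ ξ i) :
    (diagonal ξ * B + c • 1)⁻¹ * diagonal ξ
      = B⁻¹ - c • (B * (diagonal ξ * B + c • 1))⁻¹ := by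
  have hBu := (isUnit_iff_isUnit_det _).1 hB.isUnit
  have hZ := isUnit_det_diagonal_mul_add hB hc hξ
  set Z := diagonal ξ * B + c • (1 : Matrix ι ι ℝ) with hZdef
  have hX : diagonal ξ = Z * B⁻¹ - c • B⁻¹ := by
    rw [hZdef, add_mul, mul_assoc, mul_nonsing_inv _ hBu]
    simp
  rw [Matrix.mul_inv_rev, hX, mul_sub, ← mul_assoc, nonsing_inv_mul _ hZ, one_mul, mul_smul_comm]

theorem posSemidef_inv_mul_diagonal {ι : Type*} [Fintype ι] [DecidableEq ι] {B : Matrix ι ι ℝ}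
    (hB : B.PosDef) {c : ℝ} (hc : 0 < c) {ξ : ι → ℝ} (hξ : ∀ i, 0 ≤ ξ i) :
    ((diagonal ξ * B + c • 1)⁻¹ * diagonal ξ).PosSemidef := by
  have hZ := isUnit_det_diagonal_mul_add hB hc hξ
  have hX : (diagonal ξ).PosSemidef := PosSemidef.diagonal hξ
  have h1 := hB.posSemidef.conjTranspose_mul_mul_same (diagonal ξ)
  have h2 := (h1.add (hX.smul hc.le)).mul_mul_conjTranspose_same (diagonal ξ * B + c • 1)⁻¹
  set Z := diagonal ξ * B + c • (1 : Matrix ι ι ℝ) with hZdef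
  have e : (diagonal ξ)ᴴ * B * diagonal ξ + c • diagonal ξ = diagonal ξ * Zᴴ := by
    rw [hZdef, conjTranspose_add, conjTranspose_mul, hB.isHermitian.eq, hX.isHermitian.eq]
    simp [mul_add, mul_assoc]
  have hZH : IsUnit Zᴴ.det := by rw [det_conjTranspose]; exact hZ.star
  rwa [e, conjTranspose_nonsing_inv, mul_assoc, mul_assoc, mul_nonsing_inv _ hZH, mul_one] at h2

/-- Convexity of matrix inversion on positive definite matrices, in first-order form. -/
theorem posSemidef_inv_sub_tangent {ι : Type*} [Fintype ι] [DecidableEq ι] {V W : Matrix ι ι ℝ}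
    (hV : V.PosDef) (hW : W.PosDef) : (W⁻¹ - V⁻¹ + V⁻¹ * (W - V) * V⁻¹).PosSemidef := by
  have hVu := (isUnit_iff_isUnit_det _).1 hV.isUnit
  have hWu := (isUnit_iff_isUnit_det _).1 hW.isUnit
  have h := hW.posSemidef.conjTranspose_mul_mul_same (W⁻¹ - V⁻¹)
  rw [conjTranspose_sub, hW.isHermitian.inv.eq, hV.isHermitian.inv.eq] at h
  convert h using 1
  simp only [sub_mul, mul_sub, nonsing_inv_mul _ hVu, nonsing_inv_mul _ hWu, one_mul,
    mul_assoc, mul_nonsing_inv _ hWu, mul_one]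
  abel

/-- The matrix `(X B + c)⁻¹ X` lies, in the Löwner order, below its linearization. -/
theorem posSemidef_linearization_sub {ι : Type*} [Fintype ι] [DecidableEq ι] {B : Matrix ι ι ℝ}
    (hB : B.PosDef) {c : ℝ} (hc : 0 < c) {ξ η : ι → ℝ} (hξ : ∀ i, 0 ≤ ξ i) (hη : ∀ i, 0 ≤ η i) :
    (c • ((diagonal η * B + c • 1)⁻¹ * diagonal (ξ - η) * ((diagonal η * B + c • 1)ᵀ)⁻¹)
      - ((diagonal ξ * B + c • 1)⁻¹ * diagonal ξ
        - (diagonal η * B + c • 1)⁻¹ * diagonal η)).PosSemidef := by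
  have hV := posDef_mul_diagonal_mul_add hB hc hη
  have hBu := (isUnit_iff_isUnit_det _).1 hB.isUnit
  have hBt : Bᵀ = B := by simpa using hB.isHermitian.eq
  have h := (posSemidef_inv_sub_tangent hV (posDef_mul_diagonal_mul_add hB hc hξ)).smul hc.le
  rw [inv_mul_diagonal_eq hB hc hξ, inv_mul_diagonal_eq hB hc hη]
  have hdiff : B * (diagonal ξ * B + c • 1) - B * (diagonal η * B + c • 1)
      = B * diagonal (ξ - η) * B := by
    rw [← mul_sub, add_sub_add_right_eq_sub, ← sub_mul, diagonal_sub, ← mul_assoc]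
    rfl
  have hsymm : (B * (diagonal η * B + c • 1))⁻¹ = B⁻¹ * ((diagonal η * B + c • 1)ᵀ)⁻¹ := by
    rw [← Matrix.mul_inv_rev]
    congr 1
    simp [hBt, mul_add, add_mul, mul_assoc]
  have hprod : (B * (diagonal η * B + c • 1))⁻¹ * (B * diagonal (ξ - η) * B)
      * (B * (diagonal η * B + c • 1))⁻¹
      = (diagonal η * B + c • 1)⁻¹ * diagonal (ξ - η) * ((diagonal η * B + c • 1)ᵀ)⁻¹ := by
    nth_rewrite 2 [hsymm]
    rw [Matrix.mul_inv_rev]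
    simp only [mul_assoc]
    rw [mul_nonsing_inv_cancel_left _ _ hBu, nonsing_inv_mul_cancel_left _ _ hBu]
  rw [hdiff, hprod] at h
  convert h using 1
  module

/-- **Theorem 2** (δ-approximate optimality): if for every subset `S` of
cardinality `n` one has `(1/n) ∑_{i ∈ S} h i ≤ ∑_i ξ̄ i * h i + δ`, then
`Φ(L ξ̄) ≥ Φ(L ξ) - (κ/n)·δ` for every `ξ ∈ Ξ`. -/
theorem stmt_14 (N n p : ℕ) (hN : 0 < N) (hn : 0 < n) (hp : 0 < p) (hnN : n ≤ N)
    (C : Matrix (Fin N) (Fin N) ℝ) (hC : C.PosDef)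
    (κ : ℝ) (hκ : 0 < κ)
    (hCκ : (C - κ • (1 : Matrix (Fin N) (Fin N) ℝ)).PosDef)
    (F : Matrix (Fin N) (Fin p) ℝ)
    (Z : (Fin N → ℝ) → Matrix (Fin N) (Fin N) ℝ)
    (hZ : ∀ ξ, Z ξ = Matrix.diagonal ξ * (C - κ • 1) + (κ / (n : ℝ)) • 1)
    (L : (Fin N → ℝ) → Matrix (Fin p) (Fin p) ℝ)
    (hL : ∀ ξ, L ξ = Fᵀ * (Z ξ)⁻¹ * Matrix.diagonal ξ * F)
    (Ξ : Set (Fin N → ℝ))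
    (hΞ : Ξ = {ξ : Fin N → ℝ | ∑ i, ξ i = 1 ∧ ∀ i, 0 ≤ ξ i ∧ ξ i ≤ 1 / (n : ℝ)})
    (ξbar : Fin N → ℝ) (hξbar : ξbar ∈ Ξ)
    (Φ : Matrix (Fin p) (Fin p) ℝ → ℝ)
    (hΦconc : ConcaveOn ℝ {A : Matrix (Fin p) (Fin p) ℝ | A.PosSemidef} Φ)
    (hΦmono : ∀ A B : Matrix (Fin p) (Fin p) ℝ, (B - A).PosSemidef → Φ A ≤ Φ B)
    (D : Matrix (Fin p) (Fin p) ℝ) (hDsymm : Dᵀ = D)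
    (ψ : Matrix (Fin p) (Fin p) ℝ →L[ℝ] ℝ)
    (hψ : ∀ A : Matrix (Fin p) (Fin p) ℝ, ψ A = (D * A).trace)
    (hdiff : HasFDerivAt Φ ψ (L ξbar))
    (h : Fin N → ℝ)
    (hh : ∀ i, h i = (((Z ξbar)ᵀ)⁻¹ * F * D * Fᵀ * (Z ξbar)⁻¹) i i)
    (δ : ℝ) (hδ : 0 < δ)
    (hcond : ∀ S : Finset (Fin N), S.card = n →
      (1 / (n : ℝ)) * ∑ i ∈ S, h i ≤ (∑ i, ξbar i * h i) + δ) :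
    ∀ ξ ∈ Ξ, Φ (L ξbar) ≥ Φ (L ξ) - (κ / (n : ℝ)) * δ := by
  intro ξ hξ
  rw [hΞ] at hξ hξbar
  have hc : 0 < κ / (n : ℝ) := by positivity
  have hξ0 := fun i => (hξ.2 i).1
  have hη0 := fun i => (hξbar.2 i).1
  have hLpsd : ∀ η : Fin N → ℝ, (∀ i, 0 ≤ η i) → (L η).PosSemidef := fun η hη => by
    have := (posSemidef_inv_mul_diagonal hCκ hc hη).conjTranspose_mul_mul_same F
    rwa [hL, hZ, Matrix.mul_assoc Fᵀ]
  have htangent : Φ (L ξ) ≤ Φ (L ξbar) + ψ (L ξ - L ξbar) :=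
    hΦconc.le_add_fderiv hdiff (hLpsd _ hη0) (hLpsd _ hξ0)
  set G := (κ / (n : ℝ)) • (Fᵀ * ((Z ξbar)⁻¹ * diagonal (ξ - ξbar) * ((Z ξbar)ᵀ)⁻¹) * F) with hG
  have hGpsd : (G - (L ξ - L ξbar)).PosSemidef := by
    have := (posSemidef_linearization_sub hCκ hc hξ0 hη0).conjTranspose_mul_mul_same F
    rw [← hZ, ← hZ] at this
    convert this using 1
    simp only [hG, hL, conjTranspose_eq_transpose_of_trivial, Matrix.mul_smul, Matrix.smul_mul,
      Matrix.mul_sub, Matrix.sub_mul, Matrix.mul_assoc]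
  have hψG : ψ (L ξ - L ξbar) ≤ ψ G := by
    have := fderiv_nonneg_of_loewner_mono hΦmono hdiff hGpsd
    rw [map_sub] at this
    exact sub_nonneg.1 this
  have hGtrace : ψ G = (κ / (n : ℝ)) * (∑ i, ξ i * h i - ∑ i, ξbar i * h i) := by
    have e : (D * (Fᵀ * ((Z ξbar)⁻¹ * diagonal (ξ - ξbar) * ((Z ξbar)ᵀ)⁻¹) * F)).trace
        = (((Z ξbar)ᵀ)⁻¹ * F * D * Fᵀ * (Z ξbar)⁻¹ * diagonal (ξ - ξbar)).trace := by
      have := Matrix.trace_mul_comm (D * Fᵀ * (Z ξbar)⁻¹ * diagonal (ξ - ξbar))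
        (((Z ξbar)ᵀ)⁻¹ * F)
      simpa only [Matrix.mul_assoc] using this
    rw [hG, map_smul, hψ, e, smul_eq_mul, ← Finset.sum_sub_distrib]
    congr 1
    simp only [Matrix.trace, diag_apply, mul_diagonal, ← hh, Pi.sub_apply]
    exact Finset.sum_congr rfl fun i _ => by ring
  obtain ⟨S, hS, hle⟩ := exists_card_eq_sum_mul_le h ξ hn (by simpa using hnN) hξ.1 hξ.2
  have hgap : ∑ i, ξ i * h i - ∑ i, ξbar i * h i ≤ δ := by linarith [hcond S hS]
  have := mul_le_mul_of_nonneg_left hgap hc.le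
  linarith
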